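/- arXiv:2512.03612 — 3 statements merged into one kernel-verified Lean document; each statement's English description precedes it below -/
import Mathlib

section
/- The Expected Confidence Dependency dominates the classical Pawlak dependency: ECD(c,d) ≥ Cla(c,d). -/
open Finset

/-- Classification confidence `Conf(X→Y) = |X∩Y|/|X|` for the conditional block
`X = c⁻¹(a)` and decision class `Y = d⁻¹(b)`. -/
def Conf {U A B : Type*} [Fintype U] [DecidableEq A] [DecidableEq B]
    (c : U → A) (d : U → B) (a : A) (b : B) : ℚ :=
  ((univ.filter fun x => c x = a ∧ d x = b).card : ℚ) /
    ((univ.filter fun x => c x = a).card : ℚ)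

/-- Expected Confidence Dependency:
`ECD(c,d) = (1/|U|) · Σ_{X ∈ U/c} |X| · max_{Y ∈ U/d} Conf(X→Y)`. -/
def ECD {U A B : Type*} [Fintype U] [Nonempty U] [DecidableEq A] [DecidableEq B]
    (c : U → A) (d : U → B) : ℚ :=
  (∑ a ∈ univ.image c,
      ((univ.filter fun x => c x = a).card : ℚ) *
        (univ.image d).sup' (univ_nonempty.image d) (fun b => Conf c d a b))
    / (Fintype.card U : ℚ)

/-- The positive region `POS_c(d)`: objects whose conditional block is fully
consistent with a single decision class. -/
def POS {U A B : Type*} [Fintype U] [DecidableEq A] [DecidableEq B]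
    (c : U → A) (d : U → B) : Finset U :=
  univ.filter fun x => ∀ y : U, c y = c x → d y = d x

/-- Classical (Pawlak) dependency `Cla(c,d) = |POS_c(d)|/|U|`. -/
def Cla {U A B : Type*} [Fintype U] [DecidableEq A] [DecidableEq B]
    (c : U → A) (d : U → B) : ℚ :=
  ((POS c d).card : ℚ) / (Fintype.card U : ℚ)

/-- Within a conditional block, `|X| · Conf(X→Y) = |X∩Y|`. -/
theorem card_mul_Conf {U A B : Type*} [Fintype U] [DecidableEq A] [DecidableEq B]
    (c : U → A) (d : U → B) (a : A) (b : B) :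
    ((univ.filter fun x => c x = a).card : ℚ) * Conf c d a b =
      ((univ.filter fun x => c x = a ∧ d x = b).card : ℚ) := by
  refine mul_div_cancel_of_imp' fun h => ?_
  have hle : (univ.filter fun x => c x = a ∧ d x = b).card ≤
      (univ.filter fun x => c x = a).card :=
    card_le_card (monotone_filter_right _ fun _ _ h => h.1)
  rw [Nat.cast_eq_zero] at h ⊢
  omega

/-- The part of the positive region inside a conditional block lies in a single decision class,
so its size is at most `|X| · max_Y Conf(X→Y)`. -/
theorem card_POS_filter_le {U A B : Type*} [Fintype U] [Nonempty U]
    [DecidableEq A] [DecidableEq B] (c : U → A) (d : U → B) (a : A) :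
    (((POS c d).filter fun x => c x = a).card : ℚ) ≤
      ((univ.filter fun x => c x = a).card : ℚ) *
        (univ.image d).sup' (univ_nonempty.image d) (fun b => Conf c d a b) := by
  obtain ⟨x, hx⟩ : ∃ x : U, ∀ y ∈ (POS c d).filter fun x => c x = a, d y = d x := by
    by_cases h : ((POS c d).filter fun x => c x = a).Nonempty
    · obtain ⟨x, hx⟩ := h
      simp only [POS, mem_filter, mem_univ, true_and] at hx
      refine ⟨x, fun y hy => hx.1 y ?_⟩
      rw [(mem_filter.1 hy).2, hx.2]
    · exact ⟨Classical.arbitrary U, fun y hy => (h ⟨y, hy⟩).elim⟩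
  calc (((POS c d).filter fun x => c x = a).card : ℚ)
      ≤ ((univ.filter fun y => c y = a ∧ d y = d x).card : ℚ) := by
        exact Nat.cast_le.2 <| card_le_card fun y hy =>
          mem_filter.2 ⟨mem_univ y, (mem_filter.1 hy).2, hx y hy⟩
    _ = ((univ.filter fun x => c x = a).card : ℚ) * Conf c d a (d x) :=
        (card_mul_Conf c d a (d x)).symm
    _ ≤ _ := by
        gcongr
        exact le_sup' (fun b => Conf c d a b) (mem_image_of_mem d (mem_univ x))

/-- ECD dominates the classical Pawlak dependency. -/
theorem ECD_ge_Cla {U A B : Type*} [Fintype U] [Nonempty U]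
    [DecidableEq A] [DecidableEq B] (c : U → A) (d : U → B) :
    Cla c d ≤ ECD c d := by
  unfold Cla ECD
  gcongr
  rw [card_eq_sum_card_fiberwise (f := c) (t := univ.image c)
    fun x _ => mem_coe.2 (mem_image_of_mem c (mem_univ x)), Nat.cast_sum]
  exact sum_le_sum fun a _ => card_POS_filter_le c d a
end

section
/- Additivity of ECD over disjoint universes: suppose U is partitioned into two nonempty disjoint subsets U₁ and U₂ such that every conditional block of c lies entirely within U₁ or entirely within U₂ (that is, for all x, y ∈ U, c(x) = c(y) implies that x ∈ U₁ if and only if y ∈ U₁). Then ECD computed on U equals the size-weighted average of the ECD values of the restricted systems: ECD_U(c,d) = (|U₁|/|U|)·ECD_{U₁}(c|_{U₁}, d|_{U₁}) + (|U₂|/|U|)·ECD_{U₂}(c|_{U₂}, d|_{U₂}). -/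
open Finset

/-- Expected Confidence Dependency computed on a (nonempty) finite sub-universe
`s`, with conditional map `c` and decision map `d` restricted to `s`:
`ECD_s(c,d) = (1/|s|) · Σ_{X ∈ s/c} |X| · max_{Y ∈ s/d} |X∩Y|/|X|`. -/
def ECDon {U A B : Type*} [DecidableEq A] [DecidableEq B]
    (s : Finset U) (hs : s.Nonempty) (c : U → A) (d : U → B) : ℚ :=
  (∑ a ∈ s.image c,
      ((s.filter fun x => c x = a).card : ℚ) *
        (s.image d).sup' (hs.image d) (fun b =>
          ((s.filter fun x => c x = a ∧ d x = b).card : ℚ) /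
            ((s.filter fun x => c x = a).card : ℚ)))
    / (s.card : ℚ)

/-- The filtered subset of `t` on a fibre contained in `s ⊆ t` is the one of `s`. -/
theorem filter_fiber_eq_of_subset {U A : Type*} [DecidableEq A] {c : U → A} {s t : Finset U}
    (hst : s ⊆ t) {a : A} (ha : ∀ x ∈ t, c x = a → x ∈ s) (p : U → Prop) [DecidablePred p] :
    (t.filter fun x => c x = a ∧ p x) = s.filter fun x => c x = a ∧ p x := by
  ext x
  simp only [mem_filter]
  exact ⟨fun h => ⟨ha x h.1 h.2.1, h.2⟩, fun h => ⟨hst h.1, h.2⟩⟩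

/-- The maximal confidence of a block contained in `s ⊆ t` may be computed in `s` or in `t`. -/
theorem sup'_confidence_eq_of_subset {U A B : Type*} [DecidableEq A] [DecidableEq B]
    {c : U → A} {d : U → B} {s t : Finset U} (hst : s ⊆ t) (hs : s.Nonempty) (ht : t.Nonempty)
    {a : A} (ha : ∀ x ∈ t, c x = a → x ∈ s) (n : ℚ) (hn : 0 ≤ n) :
    (t.image d).sup' (ht.image d)
        (fun b => ((t.filter fun x => c x = a ∧ d x = b).card : ℚ) / n) =
      (s.image d).sup' (hs.image d)
        (fun b => ((s.filter fun x => c x = a ∧ d x = b).card : ℚ) / n) := by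
  simp only [filter_fiber_eq_of_subset hst ha]
  apply le_antisymm
  · refine sup'_le _ _ fun b _ => ?_
    by_cases hbs : b ∈ s.image d
    · exact le_sup' (fun b => ((s.filter fun x => c x = a ∧ d x = b).card : ℚ) / n) hbs
    · have hempty : (s.filter fun x => c x = a ∧ d x = b) = ∅ :=
        filter_eq_empty_iff.2 fun x hx h => hbs (mem_image.2 ⟨x, hx, h.2⟩)
      obtain ⟨b', hb'⟩ := hs.image d
      rw [hempty, card_empty, Nat.cast_zero, zero_div]
      exact (by positivity : (0 : ℚ) ≤ _).trans
        (le_sup' (fun b => ((s.filter fun x => c x = a ∧ d x = b).card : ℚ) / n) hb')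
  · exact sup'_mono _ (image_subset_image hst) _

/-- If `s ⊆ t` is a union of conditional blocks of `t`, then `|s| · ECD_s` is the sum over
these blocks of the terms of `ECD_t`. -/
theorem card_mul_ECDon_eq_sum {U A B : Type*} [DecidableEq A] [DecidableEq B]
    (c : U → A) (d : U → B) {s t : Finset U} (hst : s ⊆ t) (hs : s.Nonempty) (ht : t.Nonempty)
    (hsat : ∀ x ∈ s, ∀ y ∈ t, c y = c x → y ∈ s) :
    (s.card : ℚ) * ECDon s hs c d =
      ∑ a ∈ s.image c,
        ((t.filter fun x => c x = a).card : ℚ) *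
          (t.image d).sup' (ht.image d) (fun b =>
            ((t.filter fun x => c x = a ∧ d x = b).card : ℚ) /
              ((t.filter fun x => c x = a).card : ℚ)) := by
  have hcard : (s.card : ℚ) ≠ 0 := Nat.cast_ne_zero.2 hs.card_pos.ne'
  rw [ECDon, mul_div_cancel₀ _ hcard]
  refine sum_congr rfl fun a ha => ?_
  obtain ⟨x, hx, rfl⟩ := mem_image.1 ha
  have hfib : (t.filter fun y => c y = c x) = s.filter fun y => c y = c x := by
    simpa using filter_fiber_eq_of_subset hst (hsat x hx) fun _ => True
  rw [sup'_confidence_eq_of_subset hst hs ht (hsat x hx) _ (Nat.cast_nonneg _), hfib]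

/-- Additivity of ECD over disjoint universes: if `U = U₁ ⊎ U₂` with every
conditional block of `c` lying entirely within `U₁` or within `U₂`, then the
ECD on `U` is the size-weighted average of the ECD values of the two
restricted systems. -/
theorem ECD_additive {U A B : Type*} [Fintype U] [DecidableEq U]
    [DecidableEq A] [DecidableEq B]
    (c : U → A) (d : U → B) (U₁ U₂ : Finset U)
    (h₁ : U₁.Nonempty) (h₂ : U₂.Nonempty)
    (hdisj : Disjoint U₁ U₂) (hunion : U₁ ∪ U₂ = Finset.univ)
    (hblocks : ∀ x y : U, c x = c y → (x ∈ U₁ ↔ y ∈ U₁)) :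
    ECDon Finset.univ (h₁.mono (subset_univ U₁)) c d =
      ((U₁.card : ℚ) / (Fintype.card U : ℚ)) * ECDon U₁ h₁ c d +
        ((U₂.card : ℚ) / (Fintype.card U : ℚ)) * ECDon U₂ h₂ c d := by
  have hdisj' : Disjoint (U₁.image c) (U₂.image c) := by
    simp only [disjoint_left, mem_image]
    rintro _ ⟨x, hx, rfl⟩ ⟨y, hy, hxy⟩
    exact disjoint_left.1 hdisj ((hblocks y x hxy).2 hx) hy
  have hmem (x : U) : x ∈ U₂ ↔ x ∉ U₁ :=
    ⟨fun h₂ h₁ => disjoint_left.1 hdisj h₁ h₂,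
      fun h => (mem_union.1 (hunion ▸ mem_univ x)).resolve_left h⟩
  have hne : (univ : Finset U).Nonempty := h₁.mono (subset_univ U₁)
  rw [div_mul_eq_mul_div, div_mul_eq_mul_div, ← add_div,
    card_mul_ECDon_eq_sum c d (subset_univ U₁) h₁ hne
      fun x hx y _ hxy => (hblocks y x hxy).2 hx,
    card_mul_ECDon_eq_sum c d (subset_univ U₂) h₂ hne
      fun x hx y _ hxy => (hmem y).2 fun hy => (hmem x).1 hx ((hblocks y x hxy).1 hy),
    ← sum_union hdisj', ← image_union, hunion, ECDon, card_univ]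
end

section
/- ECD equals the accuracy of the block-majority classifier: let h : U → B be any map that is constant on conditional blocks (for all x, y ∈ U, c(x) = c(y) implies h(x) = h(y)) and that assigns to each object a majority decision of its block, i.e., for every x ∈ U, |{y ∈ U : c(y) = c(x) and d(y) = h(x)}| = max over b ∈ B of |{y ∈ U : c(y) = c(x) and d(y) = b}|. Then the classification accuracy |{x ∈ U : h(x) = d(x)}| / |U| equals ECD(c,d). -/
open Finset

/-- The size of a block times its largest confidence is the size of the intersection with a
majority class. -/
lemma card_mul_sup'_Conf {U A B : Type*} [Fintype U] [Nonempty U]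
    [DecidableEq A] [DecidableEq B] (c : U → A) (d : U → B) (x : U) (b₀ : B)
    (hb₀ : ∀ b : B, (univ.filter fun y => c y = c x ∧ d y = b).card ≤
      (univ.filter fun y => c y = c x ∧ d y = b₀).card) :
    ((univ.filter fun y => c y = c x).card : ℚ) *
        (univ.image d).sup' (univ_nonempty.image d) (fun b => Conf c d (c x) b) =
      ((univ.filter fun y => c y = c x ∧ d y = b₀).card : ℚ) := by
  have hmem : b₀ ∈ univ.image d := by
    have hpos : 0 < (univ.filter fun y => c y = c x ∧ d y = b₀).card :=
      lt_of_lt_of_le (card_pos.2 ⟨x, by simp⟩) (hb₀ (d x))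
    obtain ⟨y, hy⟩ := card_pos.1 hpos
    exact mem_image.2 ⟨y, mem_univ y, (mem_filter.1 hy).2.2⟩
  have hsup : (univ.image d).sup' (univ_nonempty.image d) (fun b => Conf c d (c x) b) =
      Conf c d (c x) b₀ := by
    apply le_antisymm
    · refine sup'_le _ _ fun b _ => ?_
      unfold Conf
      exact div_le_div_of_nonneg_right (Nat.cast_le.2 (hb₀ b)) (Nat.cast_nonneg _)
    · exact le_sup' (fun b => Conf c d (c x) b) hmem
  have hne : ((univ.filter fun y => c y = c x).card : ℚ) ≠ 0 :=
    Nat.cast_ne_zero.2 (card_pos.2 ⟨x, by simp⟩).ne'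
  rw [hsup, Conf, mul_div_cancel₀ _ hne]

/-- ECD equals the accuracy of any block-majority classifier: if `h` is constant
on conditional blocks and assigns to each object a majority decision of its
block, then the classification accuracy of `h` equals `ECD(c,d)`. -/
theorem ECD_eq_majority_accuracy {U A B : Type*} [Fintype U] [Nonempty U]
    [DecidableEq A] [DecidableEq B] (c : U → A) (d : U → B) (h : U → B)
    (hconst : ∀ x y : U, c x = c y → h x = h y)
    (hmaj : ∀ (x : U) (b : B),
      (univ.filter fun y => c y = c x ∧ d y = b).card ≤
        (univ.filter fun y => c y = c x ∧ d y = h x).card) :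
    ((univ.filter fun x => h x = d x).card : ℚ) / (Fintype.card U : ℚ) =
      ECD c d := by
  rw [ECD]
  congr 1
  rw [card_eq_sum_card_fiberwise (f := c) (t := univ.image c)
    (fun x _ => mem_image_of_mem c (mem_univ x)), Nat.cast_sum]
  refine sum_congr rfl fun a ha => ?_
  obtain ⟨x, -, rfl⟩ := mem_image.1 ha
  rw [card_mul_sup'_Conf c d x (h x) (hmaj x), filter_filter]
  congr 2
  ext y
  simp only [mem_filter, mem_univ, true_and]
  constructor
  · rintro ⟨hd, hc⟩
    exact ⟨hc, by rw [← hd, hconst y x hc]⟩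
  · rintro ⟨hc, hd⟩
    exact ⟨by rw [hd, hconst y x hc], hc⟩
end
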